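/- Fix an integer n ≥ 2 and a real α > 0. For r > 0 (playing the role of |a_0|) define S_2(α, r) = α + α/‖M‖ and S_q(α, r) = (1/r)·Σ_{p=1}^{q−2} (‖M‖·S_{p+1}(α, r) + α)·S_{q−p}(α, r) + α + α/‖M‖ for 3 ≤ q ≤ n, and LBRC(α, r) = (1/4)·( max_{k=1,…,n−1} ( S_{k+1}(α, r)·‖M‖ / (C_{k−1}·r^{1−k/n}) )^{1/k} )^{−1}. Then for each 2 ≤ q ≤ n the function r ↦ S_q(α, r) is nonincreasing on (0, ∞) and tends to α + α/‖M‖ as r → ∞, and LBRC(α, r) → ∞ as r → ∞. -/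

import Mathlib

open Finset Filter

/-- The `(n-1) × (n-1)` real matrix with `M_{ij} = i/n` for `i ≤ j` and `M_{ij} = -(n-i)/n`
for `i > j` (1-based indices). -/
noncomputable def Mmat (n : ℕ) : Matrix (Fin (n - 1)) (Fin (n - 1)) ℝ :=
  fun i j => if (i : ℕ) ≤ (j : ℕ) then ((i : ℕ) + 1 : ℝ) / n
             else -((n : ℝ) - ((i : ℕ) + 1)) / n

/-- The row-sum norm `‖M‖ = max_i ∑_j |M_{ij}|`. -/
noncomputable def rowSumNorm (n : ℕ) : ℝ :=
  ⨆ i : Fin (n - 1), ∑ j : Fin (n - 1), |Mmat n i j|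

/-- The `r`-th Catalan number `C_r = (2r)! / ((r+1)! r!)`. -/
noncomputable def catalanC (r : ℕ) : ℝ :=
  (Nat.factorial (2 * r) : ℝ) / ((Nat.factorial (r + 1) : ℝ) * (Nat.factorial r : ℝ))

theorem rowSumNorm_pos (n : ℕ) (hn : 2 ≤ n) : 0 < rowSumNorm n := by
  have h0 : 0 < n - 1 := by omega
  have h1 : 0 < ∑ j : Fin (n - 1), |Mmat n ⟨0, h0⟩ j| := by
    apply Finset.sum_pos
    · intro j _
      have : (0 : ℝ) < n := by exact_mod_cast (by omega : 0 < n)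
      simp [Mmat]
      omega
    · exact ⟨⟨0, h0⟩, Finset.mem_univ _⟩
  exact lt_of_lt_of_le h1
    (le_ciSup (f := fun i : Fin (n - 1) => ∑ j : Fin (n - 1), |Mmat n i j|)
      (Set.finite_range _).bddAbove ⟨0, h0⟩)

theorem catalanC_pos (r : ℕ) : 0 < catalanC r := by
  unfold catalanC
  positivity

/-- For fixed `α > 0`: each `r ↦ S_q(α, r)` (`2 ≤ q ≤ n`) is nonincreasing on `(0, ∞)` and
tends to `α + α/‖M‖` as `r → ∞`, and `LBRC(α, r) → ∞` as `r → ∞`. -/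
theorem S_antitone_and_LBRC_tendsto_atTop (n : ℕ) (hn : 2 ≤ n) (α : ℝ) (hα : 0 < α)
    (S : ℝ → ℕ → ℝ)
    (hS2 : ∀ r : ℝ, 0 < r → S r 2 = α + α / rowSumNorm n)
    (hSrec : ∀ r : ℝ, 0 < r → ∀ q : ℕ, 3 ≤ q → q ≤ n → S r q =
      (1 / r) * (∑ p ∈ Finset.Icc 1 (q - 2), (rowSumNorm n * S r (p + 1) + α) * S r (q - p))
      + α + α / rowSumNorm n)
    (LBRC : ℝ → ℝ)
    (hLBRC : ∀ r : ℝ, 0 < r → LBRC r = (1 / 4) *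
      ((Finset.Icc 1 (n - 1)).sup' (Finset.nonempty_Icc.mpr (by omega))
        (fun k => (S r (k + 1) * rowSumNorm n /
          (catalanC (k - 1) * r ^ (1 - (k : ℝ) / n))) ^ ((1 : ℝ) / k)))⁻¹) :
    (∀ q : ℕ, 2 ≤ q → q ≤ n →
      AntitoneOn (fun r => S r q) (Set.Ioi (0 : ℝ)) ∧
      Filter.Tendsto (fun r => S r q) Filter.atTop (nhds (α + α / rowSumNorm n))) ∧
    Filter.Tendsto LBRC Filter.atTop Filter.atTop := by
  have hM := rowSumNorm_pos n hn
  generalize rowSumNorm n = M at *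
  have key : ∀ q : ℕ, 2 ≤ q → q ≤ n → (∀ r : ℝ, 0 < r → 0 < S r q) ∧
      AntitoneOn (fun r => S r q) (Set.Ioi (0 : ℝ)) ∧
      Filter.Tendsto (fun r => S r q) Filter.atTop (nhds (α + α / M)) := by
    intro q
    induction q using Nat.strong_induction_on with
    | _ q ih =>
      intro h2 hqn
      rcases Nat.eq_or_lt_of_le h2 with h | h3
      · subst h
        refine ⟨fun r hr => by rw [hS2 r hr]; positivity, ?_, ?_⟩
        · intro a ha b hb _
          simp only [hS2 a ha, hS2 b hb, le_refl]
        · apply tendsto_const_nhds.congr'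
          filter_upwards [eventually_gt_atTop 0] with r hr
          rw [hS2 r hr]
      · have h3 : 3 ≤ q := h3
        have ih1 : ∀ p ∈ Finset.Icc 1 (q - 2), _ := fun p hp =>
          ih (p + 1) (by rw [Finset.mem_Icc] at hp; omega)
            (by rw [Finset.mem_Icc] at hp; omega) (by rw [Finset.mem_Icc] at hp; omega)
        have ih2 : ∀ p ∈ Finset.Icc 1 (q - 2), _ := fun p hp =>
          ih (q - p) (by rw [Finset.mem_Icc] at hp; omega)
            (by rw [Finset.mem_Icc] at hp; omega) (by rw [Finset.mem_Icc] at hp; omega)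
        have hsum : ∀ r : ℝ, 0 < r →
            0 ≤ ∑ p ∈ Finset.Icc 1 (q - 2), (M * S r (p + 1) + α) * S r (q - p) := by
          intro r hr
          apply Finset.sum_nonneg
          intro p hp
          have := (ih1 p hp).1 r hr
          have := (ih2 p hp).1 r hr
          positivity
        refine ⟨fun r hr => ?_, ?_, ?_⟩
        · rw [hSrec r hr q h3 hqn]
          have := hsum r hr
          positivity
        · intro a ha b hb hab
          have ha' : 0 < a := ha
          have hb' : 0 < b := hb
          simp only [hSrec a ha q h3 hqn, hSrec b hb q h3 hqn]
          gcongr ?_ + _ + _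
          apply mul_le_mul
          · exact one_div_le_one_div_of_le ha' hab
          · apply Finset.sum_le_sum
            intro p hp
            have e1 := (ih1 p hp).2.1 ha hb hab
            have e2 := (ih2 p hp).2.1 ha hb hab
            have e3 := (ih1 p hp).1 a ha
            have e4 := (ih2 p hp).1 b hb
            simp only at e1 e2
            gcongr
          · exact hsum b hb
          · positivity
        · have hs := tendsto_finsetSum (Finset.Icc 1 (q - 2)) (fun p hp =>
            (((ih1 p hp).2.2.const_mul M).add_const α).mul (ih2 p hp).2.2)
          have h0 : Tendsto (fun r : ℝ => 1 / r) atTop (nhds 0) := by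
            simpa using tendsto_inv_atTop_zero (𝕜 := ℝ)
          have := ((h0.mul hs).add_const α).add_const (α / M)
          rw [zero_mul, zero_add] at this
          apply this.congr'
          filter_upwards [eventually_gt_atTop 0] with r hr
          rw [hSrec r hr q h3 hqn]
  refine ⟨fun q h2 hq => (key q h2 hq).2, ?_⟩
  have hne : (Finset.Icc 1 (n - 1)).Nonempty := Finset.nonempty_Icc.mpr (by omega)
  have hn0 : (0 : ℝ) < n := by exact_mod_cast (by omega : 0 < n)
  have hlim : Tendsto (fun r : ℝ => (Finset.Icc 1 (n - 1)).sup' hne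
        (fun k => (S r (k + 1) * M /
          (catalanC (k - 1) * r ^ (1 - (k : ℝ) / n))) ^ ((1 : ℝ) / k))) atTop (nhds 0) := by
    have := Tendsto.finset_sup'_nhds_apply (l := (atTop : Filter ℝ)) hne
      (f := fun k r => (S r (k + 1) * M /
          (catalanC (k - 1) * r ^ (1 - (k : ℝ) / n))) ^ ((1 : ℝ) / k)) (g := fun _ => (0 : ℝ)) ?_
    · simpa using this
    · intro k hk
      rw [Finset.mem_Icc] at hk
      have hk0 : (0 : ℝ) < k := by exact_mod_cast (by omega : 0 < k)
      have hkn : (k : ℝ) < n := by exact_mod_cast (by omega : k < n)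
      have hexp : 0 < 1 - (k : ℝ) / n := by
        rw [sub_pos, div_lt_one hn0]; exact hkn
      have hd := (tendsto_rpow_atTop hexp).const_mul_atTop (catalanC_pos (k - 1))
      have hq := ((key (k + 1) (by omega) (by omega)).2.2.mul_const M).div_atTop hd
      have := hq.rpow_const (p := (1 : ℝ) / k) (Or.inr (by positivity))
      rwa [Real.zero_rpow (by positivity)] at this
  have hpos : ∀ r : ℝ, 0 < r → 0 < (Finset.Icc 1 (n - 1)).sup' hne
        (fun k => (S r (k + 1) * M /
          (catalanC (k - 1) * r ^ (1 - (k : ℝ) / n))) ^ ((1 : ℝ) / k)) := by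
    intro r hr
    rw [Finset.lt_sup'_iff]
    refine ⟨1, Finset.mem_Icc.mpr ⟨le_refl _, by omega⟩, ?_⟩
    have := (key (1 + 1) (by omega) (by omega)).1 r hr
    have := catalanC_pos (1 - 1)
    positivity
  have hinv := Tendsto.inv_tendsto_nhdsGT_zero (tendsto_nhdsWithin_iff.mpr ⟨hlim, by
    filter_upwards [eventually_gt_atTop 0] with r hr using hpos r hr⟩)
  apply (hinv.const_mul_atTop (by norm_num : (0 : ℝ) < 1 / 4)).congr'
  filter_upwards [eventually_gt_atTop 0] with r hr
  rw [hLBRC r hr]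
  rfl
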